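/- Let Ω = {(x,y) ∈ ℝ² : y ≥ 0} be the upper half plane and L₁ = {(x,0) : x ∈ ℝ} its boundary. For t ∈ ℝ and α ∈ (0, π/2), let V_{α,t} = {(x,y) : y = |x tan α + t|}. Then the one-dimensional cone V_{α,0} is sliding minimal in Ω with sliding boundary L₁ if and only if 0 < α ≤ π/6. -/

import Mathlib

open MeasureTheory Metric Set
open scoped ENNReal NNReal Topology

noncomputable section

abbrev E2 := EuclideanSpace ℝ (Fin 2)

/-- The closed upper half plane. -/
def Omega2 : Set E2 := {p | 0 ≤ p 1}

/-- The sliding boundary: the x-axis. -/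
def Line2 : Set E2 := {p | p 1 = 0}

/-- The set Ŵ = ⋃_{t∈[0,1]} (W_t ∪ φ_t(W_t)), with W_t = {x : φ_t(x) ≠ x}. -/
def HatW2 (φ : ℝ → E2 → E2) : Set E2 :=
  ⋃ t ∈ Set.Icc (0:ℝ) 1, ({x | φ t x ≠ x} ∪ φ t '' {x | φ t x ≠ x})

/-- A sliding deformation in `ℝ²` for the domain `Ω` with sliding boundary `L`:
φ₀ = id, φ₁ Lipschitz, (t,x) ↦ φ_t(x) continuous on [0,1]×ℝ², each φ_t maps Ω into Ω
and L into L, and Ŵ is relatively compact. -/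
def IsSlidingDeformation2 (Ω L : Set E2) (φ : ℝ → E2 → E2) : Prop :=
  (∀ x, φ 0 x = x) ∧
  (∃ K : ℝ≥0, LipschitzWith K (φ 1)) ∧
  ContinuousOn (fun p : ℝ × E2 => φ p.1 p.2) (Set.Icc (0:ℝ) 1 ×ˢ Set.univ) ∧
  (∀ t ∈ Set.Icc (0:ℝ) 1, Set.MapsTo (φ t) Ω Ω) ∧
  (∀ t ∈ Set.Icc (0:ℝ) 1, Set.MapsTo (φ t) L L) ∧
  IsCompact (closure (HatW2 φ))

/-- E is sliding minimal in Ω with sliding boundary L: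
H¹(E ∩ W₁) ≤ H¹(φ₁(E ∩ W₁)) for every sliding deformation. -/
def SlidingMinimal2 (Ω L E : Set E2) : Prop :=
  IsClosed E ∧ E ⊆ Ω ∧
  ∀ φ : ℝ → E2 → E2, IsSlidingDeformation2 Ω L φ →
    μH[1] (E ∩ {x | φ 1 x ≠ x}) ≤ μH[1] (φ 1 '' (E ∩ {x | φ 1 x ≠ x}))

/-- The cone V_{α,0} = {(x,y) : y = |x tan α|} = {(x,y) : y = |x| tan α} for 0 < α < π/2. -/
def Vcone (α : ℝ) : Set E2 := {p | p 1 = |p 0| * Real.tan α}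

/-- graph of overlaps -/
def ovG {X ι : Type*} (K : Set X) (U : ι → Set X) : SimpleGraph ι where
  Adj i j := i ≠ j ∧ (K ∩ (U i ∩ U j)).Nonempty
  symm := ⟨fun i j h => ⟨h.1.symm, by rw [inter_comm (U j)]; exact h.2⟩⟩
  loopless := ⟨fun i h => h.1 rfl⟩

lemma ovG_reach {X ι : Type*} [TopologicalSpace X] (K : Set X) (hK : IsPreconnected K)
    (U : ι → Set X) (hU : ∀ i, IsOpen (U i)) (hc : K ⊆ ⋃ i, U i)
    (hne : ∀ i, (K ∩ U i).Nonempty) (i j : ι) : (ovG K U).Reachable i j := by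
  by_contra hcon
  have := hK (⋃ k ∈ {k | (ovG K U).Reachable i k}, U k)
    (⋃ k ∈ {k | ¬ (ovG K U).Reachable i k}, U k)
    (isOpen_biUnion fun k _ => hU k) (isOpen_biUnion fun k _ => hU k) ?_ ?_ ?_
  · obtain ⟨x, hx, h1, h2⟩ := this
    simp only [mem_iUnion, mem_ofPred_eq] at h1 h2
    obtain ⟨a, ha, hxa⟩ := h1
    obtain ⟨b, hb, hxb⟩ := h2
    apply hb
    refine ha.trans (SimpleGraph.Adj.reachable ⟨?_, x, hx, hxa, hxb⟩)
    rintro rfl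
    exact hb ha
  · intro x hx
    obtain ⟨k, hk⟩ := mem_iUnion.1 (hc hx)
    by_cases h : (ovG K U).Reachable i k
    · left; exact mem_biUnion (show k ∈ {k | (ovG K U).Reachable i k} from h) hk
    · right; exact mem_biUnion (show k ∈ {k | ¬ (ovG K U).Reachable i k} from h) hk
  · obtain ⟨x, hx, h⟩ := hne i
    exact ⟨x, hx, mem_biUnion (show i ∈ {k | (ovG K U).Reachable i k} from SimpleGraph.Reachable.refl i) h⟩
  · obtain ⟨x, hx, h⟩ := hne j
    exact ⟨x, hx, mem_biUnion (show j ∈ {k | ¬ (ovG K U).Reachable i k} from hcon) h⟩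

lemma ovG_walk {X ι : Type*} [PseudoEMetricSpace X] (K : Set X)
    (U : ι → Set X) {i j : ι} (w : (ovG K U).Walk i j) :
    ∀ x ∈ U i, ∀ y ∈ U j, edist x y ≤ (w.support.map fun k => ediam (U k)).sum := by
  induction w with
  | nil =>
    intro x hx y hy
    simpa using edist_le_ediam_of_mem hx hy
  | cons h p ih =>
    intro x hx y hy
    obtain ⟨z, _, hz1, hz2⟩ := h.2
    simp only [SimpleGraph.Walk.support_cons, List.map_cons, List.sum_cons]
    exact (edist_triangle x z y).trans (add_le_add (edist_le_ediam_of_mem hx hz1) (ih z hz2 y hy))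

lemma first_hit {ι : Type*} {G : SimpleGraph ι} (S : Set ι) {q a : ι} (w : G.Walk q a)
    (ha : a ∈ S) : ∃ v ∈ S, ∃ w' : G.Walk q v, ∀ u ∈ w'.support, u ∈ S → u = v := by
  induction w with
  | nil => exact ⟨_, ha, SimpleGraph.Walk.nil, by simp⟩
  | @cons u v w h p ih =>
    by_cases hu : u ∈ S
    · exact ⟨u, hu, SimpleGraph.Walk.nil, by simp⟩
    · obtain ⟨v, hv, w', hw'⟩ := ih ha
      refine ⟨v, hv, SimpleGraph.Walk.cons h w', ?_⟩
      intro x hx hxS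
      rw [SimpleGraph.Walk.support_cons, List.mem_cons] at hx
      rcases hx with rfl | hx
      · exact absurd hxS hu
      · exact hw' x hx hxS

lemma ovG_tripod {X ι : Type*} [Fintype ι] [PseudoEMetricSpace X] (K : Set X)
    (hK : IsPreconnected K)
    (U : ι → Set X) (hU : ∀ i, IsOpen (U i)) (hc : K ⊆ ⋃ i, U i)
    (hne : ∀ i, (K ∩ U i).Nonempty) (A B Q : X) (hA : A ∈ K) (hB : B ∈ K) (hQ : Q ∈ K) :
    ∃ P : X, ∃ i, edist A P + edist P B + edist Q P ≤ ∑ i, ediam (U i) + 2 * ediam (U i) := by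
  classical
  obtain ⟨a, ha⟩ := mem_iUnion.1 (hc hA)
  obtain ⟨b, hb⟩ := mem_iUnion.1 (hc hB)
  obtain ⟨q, hq⟩ := mem_iUnion.1 (hc hQ)
  obtain ⟨w0⟩ := ovG_reach K hK U hU hc hne a b
  obtain ⟨w1⟩ := ovG_reach K hK U hU hc hne q a
  obtain ⟨w, hw⟩ := w0.toPath
  obtain ⟨v, hv, w2, hw2⟩ := first_hit {u | u ∈ w.support} w1 (by simp)
  obtain ⟨w3, h3p, h3s⟩ : ∃ w3 : (ovG K U).Walk q v, w3.IsPath ∧ w3.support ⊆ w2.support :=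
    ⟨w2.toPath, w2.toPath.2, w2.support_toPath_subset_support⟩
  obtain ⟨P, -, hP⟩ := hne v
  refine ⟨P, v, ?_⟩
  have e1 := ovG_walk K U (w.takeUntil v hv) A ha P hP
  have e2 := ovG_walk K U (w.dropUntil v hv) P hP B hb
  have e3 := ovG_walk K U w3 Q hq P hP
  set d : ι → ℝ≥0∞ := fun k => ediam (U k)
  have hs : w.support = (w.takeUntil v hv).support ++ (w.dropUntil v hv).support.tail := by
    conv_lhs => rw [← w.take_spec hv]
    rw [SimpleGraph.Walk.support_append]
  have hd : ((w.dropUntil v hv).support.map d).sum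
      = d v + ((w.dropUntil v hv).support.tail.map d).sum := by
    conv_lhs => rw [← SimpleGraph.Walk.cons_tail_support]
    rw [List.map_cons, List.sum_cons]
  have h4 : ((w.takeUntil v hv).support.map d).sum + ((w.dropUntil v hv).support.map d).sum
      = (w.support.map d).sum + d v := by
    rw [hd, hs, List.map_append, List.sum_append]; ring
  have h5 : (w.support.map d).sum = ∑ k ∈ w.support.toFinset, d k :=
    (List.sum_toFinset d hw.support_nodup).symm
  have h6 : (w3.support.map d).sum = ∑ k ∈ w3.support.toFinset, d k :=
    (List.sum_toFinset d h3p.support_nodup).symm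
  have h7 : ∑ k ∈ w.support.toFinset, d k + ∑ k ∈ w3.support.toFinset, d k
      ≤ ∑ k, d k + d v := by
    rw [← Finset.sum_union_inter]
    refine add_le_add (Finset.sum_le_sum_of_subset (Finset.subset_univ _)) ?_
    calc _ ≤ ∑ k ∈ {v}, d k := by
          refine Finset.sum_le_sum_of_subset ?_
          intro k hk
          simp only [Finset.mem_inter, List.mem_toFinset] at hk
          simp [hw2 k (h3s hk.2) hk.1]
      _ = d v := by simp
  calc edist A P + edist P B + edist Q P
      ≤ (w.support.map d).sum + d v + (w3.support.map d).sum := by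
        rw [← h4]; gcongr
    _ = (∑ k ∈ w.support.toFinset, d k + ∑ k ∈ w3.support.toFinset, d k) + d v := by
        rw [h5, h6]; ring
    _ ≤ (∑ k, d k + d v) + d v := by gcongr
    _ = _ := by ring

lemma tripod {X : Type*} [EMetricSpace X] [MeasurableSpace X] [BorelSpace X] (K : Set X)
    (hK : IsPreconnected K) (hKc : IsCompact K)
    (A B Q : X) (hA : A ∈ K) (hB : B ∈ K) (hQ : Q ∈ K) (δ : ℝ≥0) (hδ : 0 < δ) :
    ∃ P : X, edist A P + edist P B + edist Q P ≤ μH[1] K + 10 * δ := by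
  by_cases htop : μH[1] K = ∞
  · exact ⟨A, by simp [htop]⟩
  have h1 : (⨅ (t : ℕ → Set X) (_ : K ⊆ ⋃ n, t n) (_ : ∀ n, ediam (t n) ≤ δ),
      ∑' n, ⨆ _ : (t n).Nonempty, ediam (t n) ^ (1:ℝ)) < μH[1] K + δ := by
    refine lt_of_le_of_lt ?_ (ENNReal.lt_add_right htop (by simpa using hδ.ne'))
    rw [Measure.hausdorffMeasure_apply]
    exact le_iSup₂_of_le (δ : ℝ≥0∞) (by simpa using hδ) le_rfl
  simp only [iInf_lt_iff] at h1
  obtain ⟨t, ht, htd, hts⟩ := h1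
  obtain ⟨ε, hε, hεs⟩ := ENNReal.exists_pos_sum_of_countable (ε := (δ:ℝ≥0∞)) (by simpa using hδ.ne') ℕ
  have hts' : ∑' n, ediam (t n) < μH[1] K + δ := by
    refine lt_of_le_of_lt (ENNReal.tsum_le_tsum fun n => ?_) hts
    rcases (t n).eq_empty_or_nonempty with h | h
    · simp [h]
    · simp [h]
  obtain ⟨D, hD⟩ := hKc.elim_finite_subcover (fun n => thickening (ε n) (t n))
    (fun n => isOpen_thickening) (ht.trans (iUnion_mono fun n =>
      self_subset_thickening (by exact_mod_cast hε n) _))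
  classical
  let D' := D.filter fun n => (K ∩ thickening (ε n) (t n)).Nonempty
  have hεle : ∀ n, (ε n : ℝ≥0∞) ≤ δ := fun n => (ENNReal.le_tsum n).trans hεs.le
  have hcov : K ⊆ ⋃ n : D', thickening (ε n) (t n) := by
    intro x hx
    obtain ⟨n, hn, hxn⟩ := mem_iUnion₂.1 (hD hx)
    exact mem_iUnion.2 ⟨⟨n, Finset.mem_filter.2 ⟨hn, x, hx, hxn⟩⟩, hxn⟩
  have hne : ∀ n : D', (K ∩ thickening (ε n) (t n)).Nonempty := by
    rintro ⟨n, hn⟩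
    exact (Finset.mem_filter.1 hn).2
  obtain ⟨P, i, hP⟩ := ovG_tripod K hK (fun n : D' => thickening (ε n) (t n))
      (fun n => isOpen_thickening) hcov hne A B Q hA hB hQ
  refine ⟨P, hP.trans ?_⟩
  have hi : ediam (thickening (ε i) (t i)) ≤ δ + 2 * δ := (ediam_thickening_le _).trans (by
    gcongr; exacts [htd _, by exact_mod_cast hεle _])
  have hsum : ∑ n : D', ediam (thickening (ε n) (t n)) ≤ (μH[1] K + δ) + 2 * δ := by
    rw [Finset.sum_coe_sort D' (fun n => ediam (thickening (ε n) (t n)))]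
    calc _ ≤ ∑ n ∈ D', (ediam (t n) + 2 * ε n) := Finset.sum_le_sum fun n _ => ediam_thickening_le _
      _ ≤ ∑' n, (ediam (t n) + 2 * ε n) := ENNReal.sum_le_tsum _
      _ = ∑' n, ediam (t n) + 2 * ∑' n, (ε n : ℝ≥0∞) := by
        rw [ENNReal.tsum_add, ENNReal.tsum_mul_left]
      _ ≤ _ := by gcongr
  calc _ ≤ ((μH[1] K + δ) + 2 * δ) + 2 * (δ + 2 * (δ:ℝ≥0∞)) := by gcongr
    _ = μH[1] K + 9 * δ := by ring
    _ ≤ _ := by gcongr; try norm_num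

lemma dist_lower (P Q : E2) (u v : ℝ) (huv : u ^ 2 + v ^ 2 ≤ 1) :
    u * (P 0 - Q 0) + v * (P 1 - Q 1) ≤ dist P Q := by
  rw [EuclideanSpace.dist_eq, Fin.sum_univ_two, Real.dist_eq, Real.dist_eq, sq_abs, sq_abs]
  apply Real.le_sqrt_of_sq_le
  have h1 := sq_nonneg (u * (P 1 - Q 1) - v * (P 0 - Q 0))
  have h2 : (u ^ 2 + v ^ 2) * ((P 0 - Q 0)^2 + (P 1 - Q 1)^2) ≤ 1 * ((P 0 - Q 0)^2 + (P 1 - Q 1)^2) := by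
    gcongr
  nlinarith

lemma steiner_lower (α R : ℝ) (hs0 : 0 ≤ Real.sin α) (hs : Real.sin α ≤ 1 / 2)
    (hc : 0 < Real.cos α)
    (A B Q P : E2) (hA0 : A 0 = -R) (hA1 : A 1 = R * Real.tan α)
    (hB0 : B 0 = R) (hB1 : B 1 = R * Real.tan α) (hQ : Q 1 = 0) :
    2 * (R / Real.cos α) ≤ dist A P + dist P B + dist Q P := by
  have hsc := Real.sin_sq_add_cos_sq α
  have e1 := dist_lower A P (-Real.cos α) (Real.sin α) (by nlinarith)
  have e2 := dist_lower P B (-Real.cos α) (-Real.sin α) (by nlinarith)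
  have e3 := dist_lower Q P 0 (-(2 * Real.sin α)) (by nlinarith)
  have e : R / Real.cos α = R * Real.cos α + Real.sin α * (R * Real.tan α) := by
    rw [Real.tan_eq_sin_div_cos]; field_simp; linear_combination -R * hsc
  rw [e]
  rw [hA0, hA1] at e1
  rw [hB0, hB1] at e2
  rw [hQ] at e3
  linarith

lemma norm_pt (x y : ℝ) : ‖(!₂[x, y] : E2)‖ = Real.sqrt (x ^ 2 + y ^ 2) := by
  rw [EuclideanSpace.norm_eq]; simp

lemma dist_pt (x y z w : ℝ) : dist (!₂[x, y] : E2) !₂[z, w] = Real.sqrt ((x - z) ^ 2 + (y - w) ^ 2) := by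
  rw [EuclideanSpace.dist_eq]; simp [Real.dist_eq]

lemma E2_eta (p : E2) : p = !₂[p 0, p 1] := by
  ext i; fin_cases i <;> rfl

/-- the truncated cone -/
def VR (α R : ℝ) : Set E2 :=
  segment ℝ (!₂[-R, R * Real.tan α] : E2) 0 ∪ segment ℝ 0 (!₂[R, R * Real.tan α] : E2)

lemma measure_arm (α R s : ℝ) (hR : 0 ≤ R) (hc : 0 < Real.cos α) (hs : s ^ 2 = R ^ 2) :
    dist (!₂[s, R * Real.tan α] : E2) 0 = R / Real.cos α := by
  rw [dist_zero_right, norm_pt, hs]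
  have hsc := Real.sin_sq_add_cos_sq α
  rw [Real.sqrt_eq_iff_mul_self_eq (by positivity) (by positivity), Real.tan_eq_sin_div_cos]
  field_simp
  linear_combination R ^ 2 * hsc

lemma VR_measure_le (α R : ℝ) (hR : 0 ≤ R) (hc : 0 < Real.cos α) :
    μH[1] (VR α R) ≤ ENNReal.ofReal (2 * (R / Real.cos α)) := by
  refine (measure_union_le _ _).trans ?_
  rw [hausdorffMeasure_segment, hausdorffMeasure_segment, edist_comm 0, edist_dist, edist_dist,
    measure_arm α R _ hR hc (by ring), measure_arm α R _ hR hc (by ring),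
    ← ENNReal.ofReal_add (by positivity) (by positivity)]
  apply le_of_eq; congr 1; ring

lemma VR_compact (α R : ℝ) : IsCompact (VR α R) := by
  have h : ∀ x y : E2, IsCompact (segment ℝ x y) := fun x y => by
    rw [segment_eq_image_lineMap]
    exact isCompact_Icc.image (by fun_prop)
  exact (h _ _).union (h _ _)

lemma VR_conn (α R : ℝ) : IsPreconnected (VR α R) :=
  IsPreconnected.union 0 (right_mem_segment ..) (left_mem_segment ..)
    (convex_segment _ _).isPreconnected (convex_segment _ _).isPreconnected

lemma VR_subset (α R : ℝ) (hR : 0 ≤ R) (ht : 0 ≤ Real.tan α) : VR α R ⊆ Vcone α := by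
  rintro p (⟨a, b, ha, hb, hab, rfl⟩ | ⟨a, b, ha, hb, hab, rfl⟩)
  · simp [Vcone, abs_mul, abs_of_nonneg ha, abs_of_nonneg hR]; ring
  · simp [Vcone, abs_mul, abs_of_nonneg hb, abs_of_nonneg hR]; ring

lemma mem_VR (α R : ℝ) (hR : 0 < R) (p : E2) (hp : p ∈ Vcone α) (h : |p 0| ≤ R) : p ∈ VR α R := by
  have hp1 : p 1 = |p 0| * Real.tan α := hp
  rcases le_total 0 (p 0) with h0 | h0
  · right
    rw [abs_of_nonneg h0] at h hp1
    refine ⟨1 - p 0 / R, p 0 / R, ?_, by positivity, by ring, ?_⟩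
    · rw [sub_nonneg, div_le_one hR]; exact h
    · ext i; fin_cases i
      · simp; field_simp
      · simp [hp1]; field_simp
  · left
    rw [abs_of_nonpos h0] at h hp1
    refine ⟨-p 0 / R, 1 - (-p 0 / R), div_nonneg (by linarith) hR.le, ?_, by ring, ?_⟩
    · rw [sub_nonneg, div_le_one hR]; exact h
    · ext i; fin_cases i
      · simp; field_simp
      · simp [hp1]; field_simp

lemma Vcone_closed (α : ℝ) : IsClosed (Vcone α) :=
  isClosed_eq (by fun_prop) (by fun_prop)

lemma abs_coord_le (p : E2) (i : Fin 2) : |p i| ≤ ‖p‖ := by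
  simpa using PiLp.norm_apply_le p i

lemma minimal_of_le (α : ℝ) (h0 : 0 < α) (h1 : α ≤ Real.pi / 6) :
    SlidingMinimal2 Omega2 Line2 (Vcone α) := by
  have hpi := Real.pi_pos
  have hc : 0 < Real.cos α := Real.cos_pos_of_mem_Ioo ⟨by linarith, by linarith⟩
  have hs0 : 0 ≤ Real.sin α := Real.sin_nonneg_of_nonneg_of_le_pi h0.le (by linarith)
  have hs : Real.sin α ≤ 1 / 2 := by
    rw [← Real.sin_pi_div_six]
    exact Real.sin_le_sin_of_le_of_le_pi_div_two (by linarith) (by linarith) h1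
  have ht : 0 ≤ Real.tan α := Real.tan_nonneg_of_nonneg_of_le_pi_div_two h0.le (by linarith)
  refine ⟨Vcone_closed α, ?_, ?_⟩
  · intro p hp
    have hp1 : p 1 = |p 0| * Real.tan α := hp
    show 0 ≤ p 1
    rw [hp1]; positivity
  rintro φ ⟨-, ⟨C, hC⟩, -, -, hL, hW⟩
  set f := φ 1 with hf
  set W : Set E2 := {x | f x ≠ x} with hWdef
  have hfc : Continuous f := hC.continuous
  have hWo : IsOpen W := isOpen_ne_fun hfc continuous_id
  have hWsub : W ⊆ closure (HatW2 φ) := by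
    intro x hx
    apply subset_closure
    exact mem_biUnion (show (1:ℝ) ∈ Icc (0:ℝ) 1 by simp) (Or.inl hx)
  obtain ⟨R, hR, hWR⟩ := (hW.isBounded.subset hWsub).subset_ball_lt 0 0
  have hWR' : ∀ x ∈ W, ‖x‖ < R := fun x hx => by simpa using hWR hx
  have fix : ∀ x : E2, R ≤ |x 0| → f x = x := fun x hx => by
    by_contra h
    have := hWR' x h
    have := abs_coord_le x 0
    linarith
  have hsubV := VR_subset α R hR.le ht
  have hEW : Vcone α ∩ W ⊆ VR α R ∩ W := fun x hx =>
    ⟨mem_VR α R hR x hx.1 ((abs_coord_le x 0).trans (hWR' x hx.2).le), hx.2⟩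
  set A : E2 := !₂[-R, R * Real.tan α] with hA
  set B : E2 := !₂[R, R * Real.tan α] with hB
  have hAm : A ∈ VR α R := Or.inl (left_mem_segment ..)
  have hBm : B ∈ VR α R := Or.inr (right_mem_segment ..)
  have h0m : (0:E2) ∈ VR α R := Or.inr (left_mem_segment ..)
  have hfA : f A = A := fix A (by simp [hA, le_abs_self])
  have hfB : f B = B := fix B (by simp [hB, le_abs_self])
  have hQ : f 0 1 = 0 := hL 1 (by simp) (show (0:E2) 1 = 0 by simp)
  have key : ENNReal.ofReal (2 * (R / Real.cos α)) ≤ μH[1] (f '' VR α R) := by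
    refine ENNReal.le_of_forall_pos_le_add fun ε hε _ => ?_
    obtain ⟨P, hP⟩ := tripod (f '' VR α R) ((VR_conn α R).image f hfc.continuousOn)
      ((VR_compact α R).image hfc) A B (f 0) ⟨A, hAm, hfA⟩ ⟨B, hBm, hfB⟩ ⟨0, h0m, rfl⟩
      (ε / 10) (by positivity)
    have e : (10 : ℝ≥0∞) * ((ε / 10 : ℝ≥0) : ℝ≥0∞) = ε := by
      have : (10 : ℝ≥0) * (ε / 10) = ε := by field_simp
      exact_mod_cast congrArg ((↑) : ℝ≥0 → ℝ≥0∞) this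
    rw [e] at hP
    refine le_trans ?_ hP
    rw [edist_dist, edist_dist, edist_dist, ← ENNReal.ofReal_add dist_nonneg dist_nonneg,
      ← ENNReal.ofReal_add (by positivity) dist_nonneg]
    exact ENNReal.ofReal_le_ofReal
      (steiner_lower α R hs0 hs hc A B (f 0) P (by simp [hA]) (by simp [hA]) (by simp [hB])
        (by simp [hB]) hQ)
  have hle := VR_measure_le α R hR.le hc
  have hsplit : μH[1] (VR α R ∩ W) + μH[1] (VR α R \ W) = μH[1] (VR α R) :=
    measure_inter_add_sdiff _ hWo.measurableSet
  have hcov : f '' VR α R ⊆ f '' (Vcone α ∩ W) ∪ (VR α R \ W) := by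
    rintro _ ⟨x, hx, rfl⟩
    by_cases hxW : x ∈ W
    · exact Or.inl ⟨x, ⟨hsubV hx, hxW⟩, rfl⟩
    · have : f x = x := by simpa [hWdef] using hxW
      right; rw [this]; exact ⟨hx, hxW⟩
  have hfin : μH[1] (VR α R \ W) ≠ ∞ :=
    ne_top_of_le_ne_top ENNReal.ofReal_ne_top ((measure_mono sdiff_subset).trans hle)
  refine (measure_mono hEW).trans ?_
  refine (ENNReal.add_le_add_iff_right hfin).1 ?_
  rw [hsplit]
  exact hle.trans (key.trans ((measure_mono hcov).trans (measure_union_le _ _)))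
/-- Lipschitz with some constant -/
def IsLip (f : E2 → ℝ) : Prop := ∃ K : ℝ≥0, LipschitzWith K f

lemma IsLip.max {f g : E2 → ℝ} (hf : IsLip f) (hg : IsLip g) : IsLip fun p => Max.max (f p) (g p) := by
  obtain ⟨K, hK⟩ := hf; obtain ⟨K', hK'⟩ := hg; exact ⟨_, hK.max hK'⟩

lemma IsLip.min {f g : E2 → ℝ} (hf : IsLip f) (hg : IsLip g) : IsLip fun p => Min.min (f p) (g p) := by
  obtain ⟨K, hK⟩ := hf; obtain ⟨K', hK'⟩ := hg; exact ⟨_, hK.min hK'⟩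

lemma IsLip.add {f g : E2 → ℝ} (hf : IsLip f) (hg : IsLip g) : IsLip fun p => f p + g p := by
  obtain ⟨K, hK⟩ := hf; obtain ⟨K', hK'⟩ := hg; exact ⟨_, hK.add hK'⟩

lemma IsLip.sub {f g : E2 → ℝ} (hf : IsLip f) (hg : IsLip g) : IsLip fun p => f p - g p := by
  obtain ⟨K, hK⟩ := hf; obtain ⟨K', hK'⟩ := hg; exact ⟨_, hK.sub hK'⟩

lemma IsLip.neg {f : E2 → ℝ} (hf : IsLip f) : IsLip fun p => - f p := by
  obtain ⟨K, hK⟩ := hf; exact ⟨_, hK.neg⟩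

lemma IsLip.abs {f : E2 → ℝ} (hf : IsLip f) : IsLip fun p => |f p| := hf.max hf.neg

lemma IsLip.const (c : ℝ) : IsLip fun _ => c := ⟨0, LipschitzWith.const c⟩

lemma IsLip.coord (i : Fin 2) : IsLip fun p => p i :=
  ⟨1, LipschitzWith.of_dist_le_mul fun p q => by
    have := abs_coord_le (p - q) i
    simpa [Real.dist_eq, dist_eq_norm] using this⟩

lemma IsLip.smul {f : E2 → ℝ} (c : ℝ) (hf : IsLip f) : IsLip fun p => c * f p := by
  obtain ⟨K, hK⟩ := hf
  refine ⟨Real.nnabs c * K, LipschitzWith.of_dist_le_mul fun p q => ?_⟩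
  have := hK.dist_le_mul p q
  rw [Real.dist_eq] at this ⊢
  rw [← mul_sub, abs_mul]
  rw [NNReal.coe_mul, Real.coe_nnabs, mul_assoc]
  exact mul_le_mul_of_nonneg_left this (abs_nonneg c)

lemma norm_le_coords (p : E2) : ‖p‖ ≤ |p 0| + |p 1| := by
  rw [EuclideanSpace.norm_eq, Fin.sum_univ_two]
  apply Real.sqrt_le_iff.2 ⟨by positivity, ?_⟩
  simp only [Real.norm_eq_abs]
  nlinarith [abs_nonneg (p 0), abs_nonneg (p 1), mul_nonneg (abs_nonneg (p 0)) (abs_nonneg (p 1))]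

lemma IsLip.mk2 {f g : E2 → ℝ} (hf : IsLip f) (hg : IsLip g) :
    ∃ K : ℝ≥0, LipschitzWith K fun p => (!₂[f p, g p] : E2) := by
  obtain ⟨K, hK⟩ := hf; obtain ⟨K', hK'⟩ := hg
  refine ⟨K + K', LipschitzWith.of_dist_le_mul fun p q => ?_⟩
  have h1 := hK.dist_le_mul p q
  have h2 := hK'.dist_le_mul p q
  rw [Real.dist_eq] at h1 h2
  rw [dist_eq_norm]
  refine (norm_le_coords _).trans ?_
  simp
  linarith

/-- tent cutoff -/
def tentM (T : ℝ) (p : E2) : ℝ := max 0 (min (T⁻¹ * |p 1|) (min (1 - |p 0|) (1 - T⁻¹ * |p 1|)))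

/-- vertical amount -/
def tentV (T : ℝ) (p : E2) : ℝ := min |p 0| (tentM T p)

/-- horizontal amount -/
def tentH (T : ℝ) (p : E2) : ℝ := max (-tentM T p) (min (p 0) (tentM T p))

/-- the competitor deformation -/
def defo (T c t : ℝ) (p : E2) : E2 := !₂[p 0 - t * tentH T p, p 1 + t * (c * tentV T p)]

lemma tentM_lip (T : ℝ) : IsLip (tentM T) :=
  (IsLip.const 0).max (((IsLip.coord 1).abs.smul _).min
    (((IsLip.const 1).sub (IsLip.coord 0).abs).min
      ((IsLip.const 1).sub ((IsLip.coord 1).abs.smul _))))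

lemma tentV_lip (T : ℝ) : IsLip (tentV T) := (IsLip.coord 0).abs.min (tentM_lip T)

lemma tentH_lip (T : ℝ) : IsLip (tentH T) :=
  (tentM_lip T).neg.max ((IsLip.coord 0).min (tentM_lip T))

lemma tentM_nonneg (T : ℝ) (p : E2) : 0 ≤ tentM T p := le_max_left _ _

lemma tentM_le_one (T : ℝ) (p : E2) : tentM T p ≤ 1 := by
  refine max_le zero_le_one ((min_le_right _ _).trans ((min_le_left _ _).trans ?_))
  linarith [abs_nonneg (p 0)]

lemma tentM_le (T : ℝ) (hT : 0 < T) (p : E2) : tentM T p ≤ T⁻¹ * |p 1| :=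
  max_le (by positivity) (min_le_left _ _)

lemma tentM_zero (T : ℝ) (hT : 0 < T) (p : E2) (h : 1 ≤ |p 0| ∨ T ≤ |p 1|) : tentM T p = 0 := by
  apply le_antisymm _ (tentM_nonneg _ _)
  refine max_le le_rfl ?_
  rcases h with h | h
  · exact (min_le_right _ _).trans ((min_le_left _ _).trans (by linarith))
  · refine (min_le_right _ _).trans ((min_le_right _ _).trans ?_)
    have : 1 ≤ T⁻¹ * |p 1| := by
      rw [inv_mul_eq_div, le_div_iff₀ hT]; linarith
    linarith

lemma tentV_nonneg (T : ℝ) (p : E2) : 0 ≤ tentV T p := le_min (abs_nonneg _) (tentM_nonneg _ _)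

lemma tentV_le (T : ℝ) (p : E2) : tentV T p ≤ tentM T p := min_le_right _ _

lemma tentH_abs_le (T : ℝ) (p : E2) : |tentH T p| ≤ tentM T p := by
  have := tentM_nonneg T p
  rw [abs_le]
  exact ⟨le_max_left _ _, max_le (by linarith) (min_le_right _ _)⟩

lemma defo_fix (T c t : ℝ) (p : E2) (h : tentM T p = 0) : defo T c t p = p := by
  have h1 : tentH T p = 0 := by simpa [h] using tentH_abs_le T p
  have h2 : tentV T p = 0 := le_antisymm (h ▸ tentV_le T p) (tentV_nonneg T p)
  conv_rhs => rw [E2_eta p]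
  simp [defo, h1, h2]

lemma defo_sliding (T c : ℝ) (hT : 0 < T) (hc : -T ≤ c) :
    IsSlidingDeformation2 Omega2 Line2 (defo T c) := by
  refine ⟨fun x => ?_, ?_, ?_, ?_, ?_, ?_⟩
  · conv_rhs => rw [E2_eta x]
    simp [defo]
  · exact ((IsLip.coord 0).sub ((tentH_lip T).smul 1)).mk2
      ((IsLip.coord 1).add (((tentV_lip T).smul c).smul 1))
  · apply Continuous.continuousOn
    obtain ⟨_, h1⟩ := tentH_lip T
    obtain ⟨_, h2⟩ := tentV_lip T
    have h1 := h1.continuous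
    have h2 := h2.continuous
    unfold defo
    refine (PiLp.continuous_toLp 2 _).comp (continuous_pi fun i => ?_)
    fin_cases i <;> simp <;> fun_prop
  · intro t ht p hp
    have hp : 0 ≤ p 1 := hp
    show 0 ≤ (defo T c t p) 1
    simp only [defo]
    have h1 := tentV_nonneg T p
    have h2 := (tentV_le T p).trans (tentM_le T hT p)
    rw [abs_of_nonneg hp] at h2
    have h3 : T * tentV T p ≤ p 1 := by
      rw [inv_mul_eq_div, le_div_iff₀ hT] at h2; linarith
    have h4 : -T * tentV T p ≤ c * tentV T p := by gcongr
    have h5 : t * (T * tentV T p) ≤ 1 * (T * tentV T p) := by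
      have := ht.2
      gcongr
    have h6 : t * (-T * tentV T p) ≤ t * (c * tentV T p) := by
      have := ht.1
      gcongr
    simp
    linarith
  · intro t ht p hp
    have hp : p 1 = 0 := hp
    have : tentM T p = 0 := le_antisymm (by simpa [hp] using tentM_le T hT p) (tentM_nonneg _ _)
    rw [defo_fix _ _ _ _ this]
    exact hp
  · apply Bornology.IsBounded.isCompact_closure
    refine (isBounded_closedBall (x := (0:E2)) (r := (2 + (T + |c|)))).subset ?_
    intro q hq
    simp only [HatW2, mem_iUnion] at hq
    obtain ⟨t, ht, hq⟩ := hq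
    have key : ∀ p, defo T c t p ≠ p → |p 0| ≤ 1 ∧ |p 1| ≤ T := fun p hp => by
      by_contra hcon
      apply hp
      apply defo_fix
      apply tentM_zero T hT
      rw [not_and_or] at hcon
      push Not at hcon
      exact hcon.imp le_of_lt le_of_lt
    rw [mem_closedBall_zero_iff]
    rcases hq with hq | ⟨p, hp, rfl⟩
    · obtain ⟨h1, h2⟩ := key q hq
      have := norm_le_coords q
      have := abs_nonneg c
      linarith
    · obtain ⟨h1, h2⟩ := key p hp
      refine (norm_le_coords _).trans ?_
      have hM := tentM_le_one T p
      have e1 : |t * tentH T p| ≤ 1 := by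
        rw [abs_mul, abs_of_nonneg ht.1]
        exact mul_le_one₀ ht.2 (abs_nonneg _) ((tentH_abs_le T p).trans hM)
      have e2 : |t * (c * tentV T p)| ≤ |c| := by
        have hv : tentV T p ≤ 1 := (tentV_le T p).trans hM
        rw [abs_mul, abs_mul, abs_of_nonneg ht.1, abs_of_nonneg (tentV_nonneg T p)]
        have h3 : |c| * tentV T p ≤ |c| := mul_le_of_le_one_right (abs_nonneg c) hv
        exact (mul_le_of_le_one_left (mul_nonneg (abs_nonneg c) (tentV_nonneg T p)) ht.2).trans h3
      have e3 := abs_sub (p 0) (t * tentH T p)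
      have e4 := abs_add_le (p 1) (t * (c * tentV T p))
      simp only [defo]
      simp
      linarith

lemma tentM_cone (T : ℝ) (hT : 0 < T) (p : E2) (hp : p 1 = |p 0| * T) :
    tentM T p = max 0 (min |p 0| (1 - |p 0|)) := by
  have : T⁻¹ * |p 1| = |p 0| := by
    rw [hp, abs_mul, abs_abs, abs_of_pos hT]; field_simp
  rw [tentM, this]; simp

lemma defo_moves (T c : ℝ) (hT : 0 < T) (p : E2) (hp : p 1 = |p 0| * T) (h0 : p 0 ≠ 0)
    (h1 : |p 0| < 1) : defo T c 1 p ≠ p := by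
  intro h
  have hM : 0 < tentM T p := by
    rw [tentM_cone T hT p hp]
    exact lt_max_of_lt_right (lt_min (abs_pos.2 h0) (by linarith))
  have h2 : tentH T p = 0 := by
    have := congrArg (fun q : E2 => q 0) h
    simpa [defo] using this
  unfold tentH at h2
  rcases lt_or_gt_of_ne h0 with hx | hx
  · have := max_lt (neg_lt_zero.2 hM) (min_lt_of_left_lt hx : min (p 0) (tentM T p) < 0)
    linarith
  · have := lt_max_of_lt_right (a := (0:ℝ)) (b := -tentM T p) (lt_min hx hM)
    linarith

lemma defo_image (T h : ℝ) (hT : 0 < T) (p : E2) (hp : p 1 = |p 0| * T)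
    (hmove : defo T (2 * h - T) 1 p ≠ p) :
    defo T (2 * h - T) 1 p ∈ segment ℝ (!₂[0, 0] : E2) !₂[0, h] ∪
      (segment ℝ (!₂[0, h] : E2) !₂[-1, T] ∪ segment ℝ (!₂[0, h] : E2) !₂[1, T]) := by
  have hM : 0 < min |p 0| (1 - |p 0|) := by
    by_contra hcon
    apply hmove
    apply defo_fix
    rw [tentM_cone T hT p hp]
    exact max_eq_left (not_lt.1 hcon)
  have hMe : tentM T p = min |p 0| (1 - |p 0|) := by
    rw [tentM_cone T hT p hp]
    exact max_eq_right hM.le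
  have hV : tentV T p = min |p 0| (1 - |p 0|) := by
    rw [tentV, hMe]; simp
  have ha : 0 < |p 0| := (lt_min_iff.1 hM).1
  have hb : 0 < 1 - |p 0| := (lt_min_iff.1 hM).2
  rcases le_total |p 0| (1 - |p 0|) with hle | hle
  · left
    rw [min_eq_left hle] at hV hMe
    have hH : tentH T p = p 0 := by
      rw [tentH, hMe, min_eq_left (le_abs_self _), max_eq_right (neg_abs_le _)]
    refine ⟨1 - 2 * |p 0|, 2 * |p 0|, by linarith, by linarith, by ring, ?_⟩
    ext i; fin_cases i
    · simp [defo, hH]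
    · simp [defo, hV, hp]; ring
  · right
    rw [min_eq_right hle] at hV hMe
    rcases le_total 0 (p 0) with hx | hx
    · right
      rw [abs_of_nonneg hx] at *
      have hH : tentH T p = 1 - p 0 := by
        rw [tentH, hMe, min_eq_right hle, max_eq_right (by linarith)]
      refine ⟨1 - (2 * p 0 - 1), 2 * p 0 - 1, by linarith, by linarith, by ring, ?_⟩
      ext i; fin_cases i
      · simp [defo, hH]; ring
      · simp [defo, hV, hp]; ring
    · left
      rw [abs_of_nonpos hx] at *
      have hH : tentH T p = -(1 - -p 0) := by
        rw [tentH, hMe, min_eq_left (by linarith), max_eq_left (by linarith)]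
      refine ⟨1 - (2 * -p 0 - 1), 2 * -p 0 - 1, by linarith, by linarith, by ring, ?_⟩
      ext i; fin_cases i
      · simp [defo, hH]; ring
      · simp [defo, hV, hp]; ring

lemma le_of_minimal (α : ℝ) (hα : α ∈ Set.Ioo 0 (Real.pi / 2))
    (hmin : SlidingMinimal2 Omega2 Line2 (Vcone α)) : α ≤ Real.pi / 6 := by
  by_contra hcon
  push Not at hcon
  have hpi := Real.pi_pos
  have hc : 0 < Real.cos α := Real.cos_pos_of_mem_Ioo ⟨by linarith [hα.1], hα.2⟩
  obtain ⟨k, hk⟩ : ∃ k : ℝ, k = 1 / √3 := ⟨_, rfl⟩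
  have hk0 : 0 < k := by rw [hk]; positivity
  have hk2 : 3 * k ^ 2 = 1 := by rw [hk, div_pow, Real.sq_sqrt (by norm_num)]; norm_num
  have hTk : k < Real.tan α := by
    rw [hk, ← Real.tan_pi_div_six]
    exact Real.tan_lt_tan_of_lt_of_lt_pi_div_two (by linarith) hα.2 hcon
  set T := Real.tan α with hTdef
  have hT : 0 < T := hk0.trans hTk
  have hsl := defo_sliding T (2 * (T - k) - T) hT (by linarith)
  have hm := hmin.2.2 _ hsl
  set W : Set E2 := {x | defo T (2 * (T - k) - T) 1 x ≠ x} with hW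
  have hcone : ∀ p ∈ Vcone α, p 1 = |p 0| * T := fun p hp => hp
  -- upper bound
  have hup : μH[1] (defo T (2 * (T - k) - T) 1 '' (Vcone α ∩ W)) ≤ ENNReal.ofReal (T + 3 * k) := by
    have hsub : defo T (2 * (T - k) - T) 1 '' (Vcone α ∩ W) ⊆
        segment ℝ (!₂[0, 0] : E2) !₂[0, T - k] ∪
          (segment ℝ (!₂[0, T - k] : E2) !₂[-1, T] ∪ segment ℝ (!₂[0, T - k] : E2) !₂[1, T]) := by
      rintro _ ⟨p, ⟨hp, hpW⟩, rfl⟩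
      exact defo_image T (T - k) hT p (hcone p hp) hpW
    refine (measure_mono hsub).trans ((measure_union_le _ _).trans
      ((add_le_add_right (measure_union_le _ _) _).trans ?_))
    have e : √(1 + k ^ 2) = 2 * k := by
      rw [Real.sqrt_eq_iff_mul_self_eq (by positivity) (by positivity)]; linarith
    have d1 : dist (!₂[0, 0] : E2) !₂[0, T - k] = T - k := by
      rw [dist_pt]
      have : ((0:ℝ) - 0) ^ 2 + (0 - (T - k)) ^ 2 = (T - k) ^ 2 := by ring
      rw [this, Real.sqrt_sq (by linarith)]
    have d2 : dist (!₂[0, T - k] : E2) !₂[-1, T] = 2 * k := by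
      rw [dist_pt, ← e]; congr 1; ring
    have d3 : dist (!₂[0, T - k] : E2) !₂[1, T] = 2 * k := by
      rw [dist_pt, ← e]; congr 1; ring
    rw [hausdorffMeasure_segment, hausdorffMeasure_segment, hausdorffMeasure_segment, edist_dist,
      edist_dist, edist_dist, d1, d2, d3, ← ENNReal.ofReal_add (by positivity) (by positivity),
      ← ENNReal.ofReal_add (by linarith) (by positivity)]
    apply ENNReal.ofReal_le_ofReal
    linarith
  -- lower bound
  have hlow : ENNReal.ofReal (2 * (1 / Real.cos α)) ≤ μH[1] (Vcone α ∩ W) := by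
    have hN : MeasurableSet {p : E2 | p 0 < 0} :=
      (isOpen_lt (by fun_prop) continuous_const).measurableSet
    rw [← measure_inter_add_sdiff (Vcone α ∩ W) hN, two_mul,
      ENNReal.ofReal_add (by positivity) (by positivity)]
    have hnull : ∀ x y : E2, μH[1] ({x, y} : Set E2) = 0 := fun x y =>
      haveI := Measure.nullSingletonClass_hausdorff E2 (d := 1) one_pos
      ((Set.toFinite _).countable).measure_zero _
    have hVR := VR_subset α 1 zero_le_one hT.le
    refine add_le_add ?_ ?_
    · have hh := hausdorffMeasure_segment (!₂[-1, 1 * Real.tan α] : E2) 0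
      rw [edist_dist, measure_arm α 1 _ zero_le_one hc (by ring)] at hh
      rw [← hh]
      have hsub : segment ℝ (!₂[-1, 1 * Real.tan α] : E2) 0 ⊆
          ((Vcone α ∩ W) ∩ {p : E2 | p 0 < 0}) ∪ {!₂[-1, 1 * Real.tan α], 0} := by
        intro p hp
        have hpV : p ∈ Vcone α := hVR (Or.inl hp)
        obtain ⟨a, b, ha, hb, hab, rfl⟩ := hp
        rcases eq_or_lt_of_le ha with ha | ha
        · right; right; simp [← ha]
        rcases eq_or_lt_of_le hb with hb | hb
        · right; left; have : a = 1 := by linarith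
          simp [← hb, this]
        left
        have h0 : (a • (!₂[-1, 1 * Real.tan α] : E2) + b • (0:E2)) 0 = -a := by simp
        refine ⟨⟨hpV, defo_moves T _ hT _ (hcone _ hpV) ?_ ?_⟩, ?_⟩
        · rw [h0]; linarith
        · rw [h0, abs_neg, abs_of_pos ha]; linarith
        · show _ < (0:ℝ)
          rw [h0]; linarith
      refine (measure_mono hsub).trans ((measure_union_le _ _).trans ?_)
      rw [hnull, add_zero]
    · have hh := hausdorffMeasure_segment (0:E2) (!₂[1, 1 * Real.tan α] : E2)
      rw [edist_comm, edist_dist, measure_arm α 1 _ zero_le_one hc (by ring)] at hh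
      rw [← hh]
      have hsub : segment ℝ (0:E2) (!₂[1, 1 * Real.tan α] : E2) ⊆
          ((Vcone α ∩ W) \ {p : E2 | p 0 < 0}) ∪ {!₂[1, 1 * Real.tan α], 0} := by
        intro p hp
        have hpV : p ∈ Vcone α := hVR (Or.inr hp)
        obtain ⟨b, a, hb, ha, hab, rfl⟩ := hp
        rcases eq_or_lt_of_le ha with ha | ha
        · right; right; simp [← ha]
        rcases eq_or_lt_of_le hb with hb | hb
        · right; left; have : a = 1 := by linarith
          simp [← hb, this]
        left
        have h0 : (b • (0:E2) + a • (!₂[1, 1 * Real.tan α] : E2)) 0 = a := by simp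
        refine ⟨⟨hpV, defo_moves T _ hT _ (hcone _ hpV) ?_ ?_⟩, ?_⟩
        · rw [h0]; linarith
        · rw [h0, abs_of_pos ha]; linarith
        · show ¬ (_ < (0:ℝ))
          rw [h0]; linarith
      refine (measure_mono hsub).trans ((measure_union_le _ _).trans ?_)
      rw [hnull, add_zero]
  have hfinal := hlow.trans (hm.trans hup)
  rw [ENNReal.ofReal_le_ofReal_iff (by positivity)] at hfinal
  have hsq : (1 / Real.cos α) ^ 2 = 1 + T ^ 2 := by
    rw [hTdef, Real.tan_eq_sin_div_cos]
    have hsc := Real.sin_sq_add_cos_sq α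
    field_simp
    linear_combination -hsc
  have hpos : 0 < 1 / Real.cos α := by positivity
  have hle : (2 * (1 / Real.cos α)) ^ 2 ≤ (T + 3 * k) ^ 2 := by gcongr
  have : 0 < (T - k) ^ 2 := pow_pos (by linarith) 2
  nlinarith

theorem stmt0 (α : ℝ) (hα : α ∈ Set.Ioo 0 (Real.pi / 2)) :
    SlidingMinimal2 Omega2 Line2 (Vcone α) ↔ 0 < α ∧ α ≤ Real.pi / 6 := by
  exact ⟨fun h => ⟨hα.1, le_of_minimal α hα h⟩, fun h => minimal_of_le α h.1 h.2⟩

end
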